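/- arXiv:1707.04754 — 2 statements merged into one kernel-verified Lean document; each statement's English description precedes it below -/
import Mathlib

section
/- Let n ≥ 1 and let (x_1,…,x_n) ∈ ℤ^n be a Casas-Alvero tuple. Suppose m ≥ 1 and l are integers with x_i ≡ l (mod m) for all i = 1,…,n. Then the integer tuple ((x_1 − l)/m, (x_2 − l)/m, …, (x_n − l)/m) is again a Casas-Alvero tuple; moreover its entries are not all equal whenever the entries of (x_1,…,x_n) are not all equal. -/
open Polynomial

/-- A tuple `(x₁,…,xₙ)` over a commutative ring is a *Casas-Alvero tuple* if, with
`f(X) = ∏ (X - xⱼ)`, for every `i = 1,…,n-1` some root `x_k` satisfies `H_i(f)(x_k) = 0`,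
where `H_i` is the `i`-th Hasse derivative. -/
def IsCasasAlvero {R : Type*} [CommRing R] {n : ℕ} (x : Fin n → R) : Prop :=
  ∀ i : ℕ, 1 ≤ i → i ≤ n - 1 → ∃ k : Fin n,
    Polynomial.eval (x k)
      (Polynomial.hasseDeriv i (∏ j : Fin n, (Polynomial.X - Polynomial.C (x j)))) = 0

/-- The `i`-th Hasse derivative of `∏ (X - x_j)` at `r` is a coefficient of
`∏ (X + (r - x_j))`. -/
theorem eval_hasseDeriv_prod_X_sub_C {R : Type*} [CommRing R] {n : ℕ} (x : Fin n → R)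
    (r : R) (i : ℕ) :
    (hasseDeriv i (∏ j, (X - C (x j)))).eval r = (∏ j, (X + C (r - x j))).coeff i := by
  rw [← taylor_coeff, taylor_apply, prod_comp]
  congr 1
  refine Finset.prod_congr rfl fun j _ => ?_
  simp only [sub_comp, X_comp, C_comp, C_sub]
  ring

/-- If `x` is the image of `y` under a non-constant affine map over a domain and `x` is a
Casas-Alvero tuple, then so is `y`. -/
theorem IsCasasAlvero.of_affine {R : Type*} [CommRing R] [IsDomain R] {n : ℕ} {x y : Fin n → R}
    {a b : R} (ha : a ≠ 0) (hxy : ∀ j, x j = a * y j + b) (hx : IsCasasAlvero x) :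
    IsCasasAlvero y := by
  intro i hi hin
  obtain ⟨k, hk⟩ := hx i hi hin
  refine ⟨k, ?_⟩
  rw [eval_hasseDeriv_prod_X_sub_C] at hk ⊢
  have hcomp : (∏ j, (X + C (x k - x j))).comp (C a * X)
      = C (a ^ n) * ∏ j, (X + C (y k - y j)) := by
    rw [prod_comp, C_pow, ← Fin.prod_const, ← Finset.prod_mul_distrib]
    refine Finset.prod_congr rfl fun j _ => ?_
    simp only [add_comp, sub_comp, mul_comp, X_comp, C_comp, hxy, C_sub, C_add, C_mul]
    ring
  have hcoeff := congrArg (coeff · i) hcomp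
  simp only [comp_C_mul_X_coeff, coeff_C_mul, hk, zero_mul] at hcoeff
  exact (mul_eq_zero.mp hcoeff.symm).resolve_left (pow_ne_zero n ha)

/-- If `(x₁,…,xₙ) ∈ ℤⁿ` is a Casas-Alvero tuple with `x_i ≡ l (mod m)` for
all `i`, then `((x₁ - l)/m, …, (xₙ - l)/m)` is again a Casas-Alvero tuple, whose entries are
not all equal whenever the entries of `(x₁,…,xₙ)` are not all equal. -/
theorem casasAlvero_int_descent (n : ℕ) (hn : 1 ≤ n) (x : Fin n → ℤ)
    (hx : IsCasasAlvero (fun i => (x i : ℚ)))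
    (m l : ℤ) (hm : 1 ≤ m) (hcong : ∀ i : Fin n, x i ≡ l [ZMOD m]) :
    IsCasasAlvero (fun i => (((x i - l) / m : ℤ) : ℚ)) ∧
      ((∃ i j : Fin n, x i ≠ x j) → ∃ i j : Fin n, (x i - l) / m ≠ (x j - l) / m) := by
  have hdiv (i : Fin n) : x i = m * ((x i - l) / m) + l := by
    rw [Int.mul_ediv_cancel' (hcong i).symm.dvd, sub_add_cancel]
  refine ⟨hx.of_affine (a := (m : ℚ)) (b := l) (by exact_mod_cast (by lia : m ≠ 0))
    fun j => by exact_mod_cast hdiv j, ?_⟩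
  rintro ⟨i, j, hij⟩
  refine ⟨i, j, fun h => hij ?_⟩
  rw [hdiv i, h, ← hdiv j]
end

section
/- Let 𝔽_q be a finite field with q elements, let J be an ideal of 𝔽_q[x_1,…,x_n], and set J' = J + ⟨x_1^q − x_1, …, x_n^q − x_n⟩. Fix the graded lexicographic monomial order on 𝔽_q[x_1,…,x_n]. Then the number of points of V(J) in 𝔽_q^n equals the number of standard monomials of J', i.e., the number of monomials x^α that do not lie in the ideal generated by the leading monomials of the nonzero elements of J'. -/
open MvPolynomial

/-- Total degree of an exponent vector. -/
def expDegree {n : ℕ} (α : Fin n →₀ ℕ) : ℕ := α.sum fun _ e => e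

/-- The graded lexicographic strict order on exponent vectors, with respect to the
variable ordering `x₁ > x₂ > ⋯ > xₙ` (i.e. smaller index means bigger variable). -/
def GrlexLT {n : ℕ} (α β : Fin n →₀ ℕ) : Prop :=
  expDegree α < expDegree β ∨
    (expDegree α = expDegree β ∧
      ∃ v : Fin n, (∀ w : Fin n, w < v → α w = β w) ∧ α v < β v)

/-- `m` is the leading monomial of the polynomial `g` w.r.t. the graded lex order:
it occurs in `g` and dominates every other monomial of `g`. -/
def IsLeadingMonomial {n : ℕ} {R : Type*} [CommSemiring R]
    (g : MvPolynomial (Fin n) R) (m : Fin n →₀ ℕ) : Prop :=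
  m ∈ g.support ∧ ∀ m' ∈ g.support, m' = m ∨ GrlexLT m' m

/-- The leading monomial for the graded lexicographic order is Mathlib's `degLex` degree. -/
theorem isLeadingMonomial_iff {n : ℕ} {R : Type*} [CommSemiring R]
    {g : MvPolynomial (Fin n) R} {m : Fin n →₀ ℕ} :
    IsLeadingMonomial g m ↔ g ≠ 0 ∧ MonomialOrder.degLex.degree g = m := by
  have key : ∀ a b : Fin n →₀ ℕ, (a = b ∨ GrlexLT a b) ↔
      MonomialOrder.degLex.toSyn a ≤ MonomialOrder.degLex.toSyn b := by
    intro a b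
    rw [le_iff_eq_or_lt, EmbeddingLike.apply_eq_iff_eq, MonomialOrder.degLex_lt_iff,
      Finsupp.DegLex.lt_iff, Finsupp.Lex.lt_iff]
    rfl
  simp only [IsLeadingMonomial, key]
  constructor
  · rintro ⟨hm, h⟩
    refine ⟨by rintro rfl; simp at hm, ?_⟩
    apply MonomialOrder.degLex.toSyn.injective
    exact le_antisymm (MonomialOrder.degLex.degree_le_iff.2 h) (MonomialOrder.le_degree hm)
  · rintro ⟨hg, rfl⟩
    exact ⟨MonomialOrder.degree_mem_support hg, fun m' hm' => MonomialOrder.le_degree hm'⟩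

/-- The standard monomials of an ideal, with respect to a monomial order. -/
def standardMonomials {σ R : Type*} [CommSemiring R] (m : MonomialOrder σ)
    (I : Ideal (MvPolynomial σ R)) : Set (σ →₀ ℕ) :=
  {d | ∀ g ∈ I, g ≠ 0 → ¬ m.degree g ≤ d}

/-- Macaulay's theorem: the polynomials supported on standard monomials form a complement of the
ideal. -/
theorem isCompl_restrictSupport_standardMonomials {σ K : Type*} [Field K] (m : MonomialOrder σ)
    (I : Ideal (MvPolynomial σ K)) :
    IsCompl (I.restrictScalars K) (restrictSupport K (standardMonomials m I)) := by
  constructor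
  · rw [Submodule.disjoint_def]
    intro f hf hs
    by_contra h0
    exact hs (m.degree_mem_support h0) f hf h0 le_rfl
  · rw [codisjoint_iff, eq_top_iff]
    rintro f -
    obtain ⟨g, r, hf, -, hr⟩ := m.div_set (B := {b | b ∈ I ∧ b ≠ 0})
      (fun b hb => isUnit_iff_ne_zero.2 (m.leadingCoeff_ne_zero_iff.2 hb.2)) f
    rw [hf]
    refine Submodule.add_mem_sup ?_ fun c hc b hb h0 => hr c hc b ⟨hb, h0⟩
    rw [Submodule.restrictScalars_mem, Finsupp.linearCombination_apply]
    exact Submodule.sum_mem _ fun b _ => I.mul_mem_left _ b.2.1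

/-- The dimension of a quotient of a polynomial ring is the number of standard monomials. -/
theorem finrank_quotient_eq_card_standardMonomials {σ K : Type*} [Field K] (m : MonomialOrder σ)
    (I : Ideal (MvPolynomial σ K)) :
    Module.finrank K (MvPolynomial σ K ⧸ I.restrictScalars K) =
      Nat.card (standardMonomials m I) := by
  rw [(Submodule.quotientEquivOfIsCompl _ _
    (isCompl_restrictSupport_standardMonomials m I)).finrank_eq,
    Module.finrank_eq_nat_card_basis (basisRestrictSupport K (standardMonomials m I))]

theorem prod_X_sub_C_eq_X_pow_card_sub_X {σ K : Type*} [Field K] [Fintype K] (i : σ) :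
    ∏ r : K, (X i - C r : MvPolynomial σ K) = X i ^ Fintype.card K - X i := by
  have h : ∏ r : K, (Polynomial.X - Polynomial.C r) =
      Polynomial.X ^ Fintype.card K - Polynomial.X := by
    have := Polynomial.prod_multiset_X_sub_C_of_monic_of_roots_card_eq
      (p := (Polynomial.X ^ Fintype.card K - Polynomial.X : Polynomial K))
      (Polynomial.monic_X_pow_sub (by
        rw [Polynomial.degree_X]; exact_mod_cast Fintype.one_lt_card))
      (by rw [FiniteField.roots_X_pow_card_sub_X,
            FiniteField.X_pow_card_sub_X_natDegree_eq K Fintype.one_lt_card]; rfl)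
    rwa [FiniteField.roots_X_pow_card_sub_X] at this
  simpa [map_prod, algebraMap_eq] using
    congrArg (Polynomial.aeval (X i : MvPolynomial σ K)) h

/-- The ideal generated by the field equations contains every polynomial that vanishes at all
points. -/
theorem mem_span_X_pow_card_sub_X {σ K : Type*} [Finite σ] [Field K] [Fintype K]
    {f : MvPolynomial σ K} (hf : ∀ a, eval a f = 0) :
    f ∈ Ideal.span (Set.range fun i : σ => (X i ^ Fintype.card K - X i : MvPolynomial σ K)) := by
  obtain ⟨h, -, hh⟩ := combinatorial_nullstellensatz_exists_linearCombination
    (fun _ : σ => (Finset.univ : Finset K)) (fun _ => Finset.univ_nonempty) f fun a _ => hf a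
  simp only [prod_X_sub_C_eq_X_pow_card_sub_X] at hh
  rw [Ideal.span, ← Finsupp.range_linearCombination]
  exact ⟨h, hh.symm⟩

/-- Nullstellensatz over a finite field. -/
theorem mem_sup_span_X_pow_card_sub_X_iff {σ K : Type*} [Finite σ] [Field K] [Fintype K]
    {J : Ideal (MvPolynomial σ K)} {f : MvPolynomial σ K} :
    f ∈ J ⊔ Ideal.span (Set.range fun i : σ =>
      (X i ^ Fintype.card K - X i : MvPolynomial σ K)) ↔
      ∀ a : σ → K, (∀ g ∈ J, eval a g = 0) → eval a f = 0 := by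
  classical
  have := Fintype.ofFinite σ
  constructor
  · intro hf a ha
    suffices J ⊔ Ideal.span (Set.range fun i : σ =>
      (X i ^ Fintype.card K - X i : MvPolynomial σ K)) ≤ RingHom.ker (eval a) from this hf
    refine sup_le ha (Ideal.span_le.2 ?_)
    rintro _ ⟨i, rfl⟩
    simp [RingHom.mem_ker, FiniteField.pow_card]
  · intro hf
    have hex : ∀ a : σ → K, ∃ g ∈ J, eval a g = eval a f := by
      intro a
      by_cases ha : ∀ g ∈ J, eval a g = 0
      · exact ⟨0, J.zero_mem, by rw [hf a ha, map_zero]⟩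
      · push Not at ha
        obtain ⟨g, hg, h0⟩ := ha
        exact ⟨C (eval a f / eval a g) * g, J.mul_mem_left _ hg, by simp [h0]⟩
    choose g hg hgf using hex
    rw [← add_sub_cancel (∑ a, indicator a * g a) f]
    refine Submodule.add_mem_sup (Submodule.sum_mem _ fun a _ => J.mul_mem_left _ (hg a))
      (mem_span_X_pow_card_sub_X fun b => ?_)
    rw [map_sub, map_sum, Finset.sum_eq_single b, map_mul, eval_indicator_apply_eq_one, one_mul,
      hgf, sub_self]
    · intro a _ hab
      rw [map_mul, eval_indicator_apply_eq_zero _ _ hab.symm, zero_mul]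
    · simp

/-- The dimension of the coordinate ring of the rational zero locus is its number of points. -/
theorem finrank_quotient_sup_span_X_pow_card_sub_X {σ K : Type*} [Finite σ] [Field K] [Fintype K]
    (J : Ideal (MvPolynomial σ K)) :
    Module.finrank K (MvPolynomial σ K ⧸ (J ⊔ Ideal.span (Set.range fun i : σ =>
      (X i ^ Fintype.card K - X i : MvPolynomial σ K))).restrictScalars K) =
      Nat.card {a : σ → K // ∀ g ∈ J, eval a g = 0} := by
  classical
  have := Fintype.ofFinite σ
  let V := {a : σ → K // ∀ g ∈ J, eval a g = 0}
  let φ : MvPolynomial σ K →ₗ[K] V → K := LinearMap.funLeft K K Subtype.val ∘ₗ evalₗ K σ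
  have hφ : Function.Surjective φ := by
    intro v
    refine ⟨∑ a, C (v a) * indicator a.1, ?_⟩
    ext b
    change eval b.1 _ = _
    rw [map_sum, Finset.sum_eq_single b]
    · simp [eval_indicator_apply_eq_one]
    · intro a _ hab
      rw [map_mul, eval_indicator_apply_eq_zero _ _ fun h => hab (Subtype.ext h.symm), mul_zero]
    · simp
  have hker : (J ⊔ Ideal.span (Set.range fun i : σ =>
      (X i ^ Fintype.card K - X i : MvPolynomial σ K))).restrictScalars K = φ.ker := by
    ext f
    rw [Submodule.restrictScalars_mem, mem_sup_span_X_pow_card_sub_X_iff, LinearMap.mem_ker,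
      funext_iff, Subtype.forall]
    rfl
  rw [hker, (φ.quotKerEquivOfSurjective hφ).finrank_eq, Module.finrank_fintype_fun_eq_card,
    Nat.card_eq_fintype_card]

/-- **counting with Gröbner bases.** For an ideal `J` of `𝔽_q[x₁,…,xₙ]` and
`J' = J + ⟨x₁^q - x₁,…,xₙ^q - xₙ⟩`, the number of points of `V(J)` in `𝔽_qⁿ` equals the
number of standard monomials of `J'` (monomials not in the ideal of leading monomials of
the nonzero elements of `J'`). -/
theorem card_zeroLocus_eq_card_standard_monomials
    (K : Type*) [Field K] [Fintype K] (q : ℕ) (hq : Fintype.card K = q)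
    (n : ℕ) (J : Ideal (MvPolynomial (Fin n) K))
    (J' : Ideal (MvPolynomial (Fin n) K))
    (hJ' : J' = J ⊔ Ideal.span (Set.range fun i : Fin n =>
      (MvPolynomial.X i ^ q - MvPolynomial.X i : MvPolynomial (Fin n) K))) :
    Nat.card {a : Fin n → K // ∀ g ∈ J, MvPolynomial.eval a g = 0} =
      Nat.card {m : Fin n →₀ ℕ //
        (MvPolynomial.monomial m (1 : K)) ∉
          Ideal.span {f : MvPolynomial (Fin n) K |
            ∃ g ∈ J', g ≠ 0 ∧ ∃ m' : Fin n →₀ ℕ,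
              IsLeadingMonomial g m' ∧ f = MvPolynomial.monomial m' (1 : K)}} := by
  subst hq hJ'
  rw [← finrank_quotient_sup_span_X_pow_card_sub_X,
    finrank_quotient_eq_card_standardMonomials MonomialOrder.degLex]
  set I := J ⊔ Ideal.span (Set.range fun i : Fin n =>
    (X i ^ Fintype.card K - X i : MvPolynomial (Fin n) K))
  have hset : {f : MvPolynomial (Fin n) K | ∃ g ∈ I, g ≠ 0 ∧ ∃ m' : Fin n →₀ ℕ,
      IsLeadingMonomial g m' ∧ f = monomial m' (1 : K)} =
      (fun s => monomial s (1 : K)) '' {s | ∃ g ∈ I, g ≠ 0 ∧ MonomialOrder.degLex.degree g = s} := by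
    ext f
    simp only [isLeadingMonomial_iff, Set.mem_ofPred_eq, Set.mem_image]
    grind
  refine Nat.card_congr (Equiv.subtypeEquivRight fun d => ?_)
  rw [hset, mem_ideal_span_monomial_image]
  simp [standardMonomials]
end
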